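/- arXiv:2304.13822 — 7 statements merged into one kernel-verified Lean document; each statement's English description precedes it below -/
import Mathlib

section
/- Let Ω be a nonempty bounded open subset of ℝ⁴ and let μ₁, μ₂, θ₁, θ₂ > 0 and 0 < β < min{μ₁, μ₂}. Let u, v : Ω → ℝ be measurable functions such that u⁺ := max{u,0} and v⁺ := max{v,0} lie in L²(Ω) ∩ L⁴(Ω) and u⁺ ≢ 0, v⁺ ≢ 0. Then the 2×2 matrix with entries M₁₁ = μ₁∫_Ω(u⁺)⁴ + θ₁∫_Ω(u⁺)², M₂₂ = μ₂∫_Ω(v⁺)⁴ + θ₂∫_Ω(v⁺)², M₁₂ = M₂₁ = β∫_Ω(u⁺)²(v⁺)² has strictly positive determinant, i.e. (μ₁∫_Ω(u⁺)⁴ + θ₁∫_Ω(u⁺)²)·(μ₂∫_Ω(v⁺)⁴ + θ₂∫_Ω(v⁺)²) > β²·(∫_Ω(u⁺)²(v⁺)²)². -/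
open MeasureTheory

noncomputable section

theorem aux_int {α : Type*} [MeasurableSpace α] {m : Measure α} {f : α → ℝ}
    (hf : MemLp f 4 m) : Integrable (fun x => f x ^ 4) m := by
  have h := hf.integrable_norm_pow (p := 4) (by norm_num)
  refine h.congr (Filter.Eventually.of_forall fun x => ?_)
  simp only [Real.norm_eq_abs]
  exact Even.pow_abs (by decide) _

theorem aux_pos {α : Type*} [MeasurableSpace α] {m : Measure α} {f : α → ℝ}
    (hf : MemLp f 4 m) (hne : ¬ (f =ᵐ[m] 0)) : 0 < ∫ x, f x ^ 4 ∂m := by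
  have h0 : ∀ x, 0 ≤ f x ^ 4 := fun x => by positivity
  refine lt_of_le_of_ne (integral_nonneg h0) fun h => hne ?_
  have := (integral_eq_zero_iff_of_nonneg h0 (aux_int hf)).1 h.symm
  filter_upwards [this] with x hx
  simpa using hx

theorem aux_cs {α : Type*} [MeasurableSpace α] {m : Measure α} {f g : α → ℝ}
    (hf : MemLp f 4 m) (hg : MemLp g 4 m) :
    (∫ x, f x ^ 2 * g x ^ 2 ∂m) ^ 2 ≤ (∫ x, f x ^ 4 ∂m) * ∫ x, g x ^ 4 ∂m := by
  have hF := aux_int hf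
  have hG := aux_int hg
  have hFG : Integrable (fun x => f x ^ 2 * g x ^ 2) m := by
    refine (hF.add hG).mono' ((hf.1.pow 2).mul (hg.1.pow 2))
      (Filter.Eventually.of_forall fun x => ?_)
    rw [Real.norm_of_nonneg (by positivity)]
    simp only [Pi.add_apply]
    nlinarith [sq_nonneg (f x ^ 2 - g x ^ 2), sq_nonneg (f x ^ 2), sq_nonneg (g x ^ 2)]
  have key : ∀ t : ℝ, 0 ≤ (∫ x, f x ^ 4 ∂m) * (t * t)
      + (-2 * ∫ x, f x ^ 2 * g x ^ 2 ∂m) * t + ∫ x, g x ^ 4 ∂m := by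
    intro t
    have h : 0 ≤ ∫ x, (t * t) * f x ^ 4 + (-2 * t) * (f x ^ 2 * g x ^ 2) + g x ^ 4 ∂m := by
      refine integral_nonneg fun x => ?_
      simp only [Pi.zero_apply]
      nlinarith [sq_nonneg (t * f x ^ 2 - g x ^ 2)]
    have hS : Integrable (fun x => (t * t) * f x ^ 4 + (-2 * t) * (f x ^ 2 * g x ^ 2)) m :=
      (hF.const_mul _).add (hFG.const_mul _)
    rw [integral_add hS hG,
      integral_add (hF.const_mul _) (hFG.const_mul _), integral_const_mul,
      integral_const_mul] at h
    linarith
  have := discrim_le_zero key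
  unfold discrim at this
  nlinarith

/-- Determinant positivity for the Nehari matrix (key step of Proposition 2.2):
for `0 < β < min{μ₁,μ₂}` and `u⁺, v⁺ ∈ L²(Ω) ∩ L⁴(Ω)` nontrivial,
`(μ₁∫(u⁺)⁴ + θ₁∫(u⁺)²)(μ₂∫(v⁺)⁴ + θ₂∫(v⁺)²) > β²(∫(u⁺)²(v⁺)²)²`. -/
theorem stmt_2 (Ω : Set (EuclideanSpace ℝ (Fin 4))) (hΩne : Ω.Nonempty)
    (hΩo : IsOpen Ω) (hΩb : Bornology.IsBounded Ω)
    (μ₁ μ₂ θ₁ θ₂ β : ℝ) (hμ₁ : 0 < μ₁) (hμ₂ : 0 < μ₂) (hθ₁ : 0 < θ₁) (hθ₂ : 0 < θ₂)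
    (hβ0 : 0 < β) (hβ : β < min μ₁ μ₂)
    (u v : EuclideanSpace ℝ (Fin 4) → ℝ) (hu : Measurable u) (hv : Measurable v)
    (hu2 : MemLp (fun x => max (u x) 0) 2 (volume.restrict Ω))
    (hu4 : MemLp (fun x => max (u x) 0) 4 (volume.restrict Ω))
    (hv2 : MemLp (fun x => max (v x) 0) 2 (volume.restrict Ω))
    (hv4 : MemLp (fun x => max (v x) 0) 4 (volume.restrict Ω))
    (hune : ¬ ((fun x => max (u x) 0) =ᵐ[volume.restrict Ω] 0))
    (hvne : ¬ ((fun x => max (v x) 0) =ᵐ[volume.restrict Ω] 0)) :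
    (μ₁ * (∫ x in Ω, (max (u x) 0) ^ 4) + θ₁ * (∫ x in Ω, (max (u x) 0) ^ 2)) *
        (μ₂ * (∫ x in Ω, (max (v x) 0) ^ 4) + θ₂ * (∫ x in Ω, (max (v x) 0) ^ 2)) >
      β ^ 2 * (∫ x in Ω, (max (u x) 0) ^ 2 * (max (v x) 0) ^ 2) ^ 2 := by
  have hA := aux_pos hu4 hune
  have hB := aux_pos hv4 hvne
  have hC := aux_cs hu4 hv4
  have hP : 0 ≤ ∫ x in Ω, (max (u x) 0) ^ 2 := integral_nonneg fun x => by positivity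
  have hQ : 0 ≤ ∫ x in Ω, (max (v x) 0) ^ 2 := integral_nonneg fun x => by positivity
  obtain ⟨h1, h2⟩ := lt_min_iff.1 hβ
  generalize (∫ x in Ω, (max (u x) 0) ^ 4) = A at *
  generalize (∫ x in Ω, (max (v x) 0) ^ 4) = B at *
  generalize (∫ x in Ω, (max (u x) 0) ^ 2 * (max (v x) 0) ^ 2) = C at *
  generalize (∫ x in Ω, (max (u x) 0) ^ 2) = P at *
  generalize (∫ x in Ω, (max (v x) 0) ^ 2) = Q at *
  calc β ^ 2 * C ^ 2 ≤ β ^ 2 * (A * B) := by gcongr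
    _ = (β * A) * (β * B) := by ring
    _ < (μ₁ * A) * (μ₂ * B) := by gcongr
    _ ≤ _ := by
      gcongr
      · exact le_add_of_nonneg_right (by positivity)
      · exact le_add_of_nonneg_right (by positivity)
end
end

section
/- Let Ω be a nonempty bounded open subset of ℝ⁴, let λ₁ ∈ ℝ, μ₁, μ₂ > 0, θ₁ > 0, and −√(μ₁μ₂) < β < 0. Suppose u, v ∈ C_c^∞(Ω) with u ≢ 0 satisfy the Nehari identity for u: ∫_Ω|∇u|² = λ₁∫_Ω(u⁺)² + μ₁∫_Ω(u⁺)⁴ + β∫_Ω(u⁺)²(v⁺)² + θ₁∫_Ω(u⁺)²log((u⁺)²). Then ∫_Ω(u⁺)⁴ ≥ S²/(μ₁ + θ₁e^{λ₁/θ₁−1})². -/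
open MeasureTheory

noncomputable section

/-- The space `ℝ⁴`, with its Lebesgue measure. -/
abbrev E4 : Type := EuclideanSpace ℝ (Fin 4)

/-- `C_c^∞(Ω)`: smooth real-valued functions with compact support contained in `Ω`,
extended by zero to `ℝ⁴`. -/
def TestFun (Ω : Set E4) (u : E4 → ℝ) : Prop :=
  ContDiff ℝ (⊤ : ℕ∞) u ∧ HasCompactSupport u ∧ tsupport u ⊆ Ω

/-- The positive part `u⁺ = max{u, 0}`. -/
def pp (u : E4 → ℝ) (x : E4) : ℝ := max (u x) 0

/-- The squared norm `|∇u|²` of the gradient. -/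
def gradSq (u : E4 → ℝ) (x : E4) : ℝ := ‖fderiv ℝ u x‖ ^ 2

/-- The best Sobolev constant `S` of the embedding `D^{1,2}(ℝ⁴) ↪ L⁴(ℝ⁴)`. -/
def sobolevS : ℝ :=
  sInf { r : ℝ | ∃ w : E4 → ℝ, ContDiff ℝ (⊤ : ℕ∞) w ∧ HasCompactSupport w ∧ w ≠ 0 ∧
    r = (∫ x, gradSq w x) / (∫ x, (w x) ^ 4) ^ ((1 : ℝ) / 2) }

/-- The first Dirichlet eigenvalue `λ₁(Ω)` of `−Δ` on `Ω`, as the infimum of the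
Rayleigh quotient over test functions. -/
def lamOne (Ω : Set E4) : ℝ :=
  sInf { r : ℝ | ∃ w : E4 → ℝ, TestFun Ω w ∧ w ≠ 0 ∧
    r = (∫ x in Ω, gradSq w x) / (∫ x in Ω, (w x) ^ 2) }

/-- The modified energy functional `ℒ(u,v)` of the system. -/
def LL (Ω : Set E4) (lam1 mu1 th1 lam2 mu2 th2 β : ℝ) (u v : E4 → ℝ) : ℝ :=
  (1 / 2) * (∫ x in Ω, gradSq u x) - (lam1 / 2) * (∫ x in Ω, (pp u x) ^ 2)
    - (mu1 / 4) * (∫ x in Ω, (pp u x) ^ 4)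
    - (th1 / 2) * (∫ x in Ω, (pp u x) ^ 2 * (Real.log ((pp u x) ^ 2) - 1))
    + (1 / 2) * (∫ x in Ω, gradSq v x) - (lam2 / 2) * (∫ x in Ω, (pp v x) ^ 2)
    - (mu2 / 4) * (∫ x in Ω, (pp v x) ^ 4)
    - (th2 / 2) * (∫ x in Ω, (pp v x) ^ 2 * (Real.log ((pp v x) ^ 2) - 1))
    - (β / 2) * (∫ x in Ω, (pp u x) ^ 2 * (pp v x) ^ 2)

/-- The pairing `ℒ'(u,v)(u,v)` of the derivative of the energy with `(u,v)`. -/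
def LLp (Ω : Set E4) (lam1 mu1 th1 lam2 mu2 th2 β : ℝ) (u v : E4 → ℝ) : ℝ :=
  (∫ x in Ω, gradSq u x) + (∫ x in Ω, gradSq v x)
    - lam1 * (∫ x in Ω, (pp u x) ^ 2) - lam2 * (∫ x in Ω, (pp v x) ^ 2)
    - mu1 * (∫ x in Ω, (pp u x) ^ 4) - mu2 * (∫ x in Ω, (pp v x) ^ 4)
    - 2 * β * (∫ x in Ω, (pp u x) ^ 2 * (pp v x) ^ 2)
    - th1 * (∫ x in Ω, (pp u x) ^ 2 * Real.log ((pp u x) ^ 2))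
    - th2 * (∫ x in Ω, (pp v x) ^ 2 * Real.log ((pp v x) ^ 2))

/-- Lemma 2.1 of the paper, case `β < 0`: if `u ∈ C_c^∞(Ω)`, `u ≢ 0`, satisfies the
Nehari identity, then `∫(u⁺)⁴ ≥ S²/(μ₁ + θ₁ e^{λ₁/θ₁−1})²`. -/
theorem stmt_4 (Ω : Set E4) (hΩne : Ω.Nonempty) (hΩo : IsOpen Ω)
    (hΩb : Bornology.IsBounded Ω)
    (lam1 μ₁ μ₂ θ₁ β : ℝ) (hμ₁ : 0 < μ₁) (hμ₂ : 0 < μ₂) (hθ₁ : 0 < θ₁)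
    (hβl : -Real.sqrt (μ₁ * μ₂) < β) (hβu : β < 0)
    (u v : E4 → ℝ) (hu : TestFun Ω u) (hv : TestFun Ω v) (hune : u ≠ 0)
    (hNehari : (∫ x in Ω, gradSq u x) =
      lam1 * (∫ x in Ω, (pp u x) ^ 2) + μ₁ * (∫ x in Ω, (pp u x) ^ 4)
        + β * (∫ x in Ω, (pp u x) ^ 2 * (pp v x) ^ 2)
        + θ₁ * (∫ x in Ω, (pp u x) ^ 2 * Real.log ((pp u x) ^ 2))) :
    (∫ x in Ω, (pp u x) ^ 4) ≥
      sobolevS ^ 2 / (μ₁ + θ₁ * Real.exp (lam1 / θ₁ - 1)) ^ 2 := by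
  obtain ⟨hus, huc, hut⟩ := hu
  have hcu : Continuous u := hus.continuous
  have hcp : Continuous (pp u) := by unfold pp; exact hcu.max continuous_const
  have hsp : HasCompactSupport (pp u) := by
    refine huc.mono ?_
    intro x hx h
    apply hx
    simp [pp, h]
  have i2 : IntegrableOn (fun x => (pp u x) ^ 2) Ω := by
    refine Integrable.integrableOn ((hcp.pow 2).integrable_of_hasCompactSupport ?_)
    exact hsp.mono (fun x hx h => hx (by simp [h]))
  have i4 : IntegrableOn (fun x => (pp u x) ^ 4) Ω := by
    refine Integrable.integrableOn ((hcp.pow 4).integrable_of_hasCompactSupport ?_)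
    exact hsp.mono (fun x hx h => hx (by simp [h]))
  have il : IntegrableOn (fun x => (pp u x) ^ 2 * Real.log ((pp u x) ^ 2)) Ω := by
    refine Integrable.integrableOn (Continuous.integrable_of_hasCompactSupport ?_ ?_)
    · exact Real.continuous_mul_log.comp (hcp.pow 2)
    · exact hsp.mono (fun x hx h => hx (by simp [h]))
  have iu : Integrable (fun x => (u x) ^ 4) := by
    refine (hcu.pow 4).integrable_of_hasCompactSupport ?_
    exact huc.mono (fun x hx h => hx (by simp [h]))
  have hG : (∫ x in Ω, gradSq u x) = ∫ x, gradSq u x := by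
    apply setIntegral_eq_integral_of_forall_compl_eq_zero
    intro x hx
    have : fderiv ℝ u x = 0 := by
      by_contra h
      exact hx (hut (support_fderiv_subset ℝ h))
    simp [gradSq, this]
  have hAB : (∫ x in Ω, (pp u x) ^ 4) ≤ ∫ x, (u x) ^ 4 := by
    refine (integral_mono i4 iu.integrableOn ?_).trans
      (setIntegral_le_integral iu (Filter.Eventually.of_forall fun x => by
        show 0 ≤ (u x) ^ 4
        positivity))
    intro x
    simp only [pp]
    rcases le_total (u x) 0 with h | h
    · rw [max_eq_right h]; simp only [ne_eq, OfNat.ofNat_ne_zero, not_false_eq_true, zero_pow]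
      positivity
    · rw [max_eq_left h]
  have hA0 : 0 ≤ ∫ x in Ω, (pp u x) ^ 4 := integral_nonneg fun x => by positivity
  have hmem : ∀ r ∈ { r : ℝ | ∃ w : E4 → ℝ, ContDiff ℝ (⊤ : ℕ∞) w ∧ HasCompactSupport w ∧ w ≠ 0 ∧
      r = (∫ x, gradSq w x) / (∫ x, (w x) ^ 4) ^ ((1 : ℝ) / 2) }, 0 ≤ r := by
    rintro r ⟨w, -, -, -, rfl⟩
    have h1 : 0 ≤ ∫ x, gradSq w x := integral_nonneg fun x => by
      show 0 ≤ ‖fderiv ℝ w x‖ ^ 2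
      positivity
    have h2 : 0 ≤ ∫ x, (w x) ^ 4 := integral_nonneg fun x => by positivity
    positivity
  have hS0 : 0 ≤ sobolevS := Real.sInf_nonneg hmem
  have hS : sobolevS ≤ (∫ x, gradSq u x) / (∫ x, (u x) ^ 4) ^ ((1 : ℝ) / 2) :=
    csInf_le ⟨0, hmem⟩ ⟨u, hus, huc, hune, rfl⟩
  have hβ : β * (∫ x in Ω, (pp u x) ^ 2 * (pp v x) ^ 2) ≤ 0 :=
    mul_nonpos_of_nonpos_of_nonneg hβu.le (integral_nonneg fun x => by positivity)
  have key : lam1 * (∫ x in Ω, (pp u x) ^ 2)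
      + θ₁ * (∫ x in Ω, (pp u x) ^ 2 * Real.log ((pp u x) ^ 2))
      ≤ θ₁ * Real.exp (lam1 / θ₁ - 1) * ∫ x in Ω, (pp u x) ^ 4 := by
    rw [← integral_const_mul, ← integral_const_mul, ← integral_const_mul,
      ← integral_add (i2.const_mul _) (il.const_mul _)]
    refine integral_mono ((i2.const_mul _).add (il.const_mul _)) (i4.const_mul _) ?_
    intro x
    show lam1 * (pp u x) ^ 2 + θ₁ * ((pp u x) ^ 2 * Real.log ((pp u x) ^ 2))
      ≤ θ₁ * Real.exp (lam1 / θ₁ - 1) * (pp u x) ^ 4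
    have e4 : (pp u x) ^ 4 = (pp u x) ^ 2 * (pp u x) ^ 2 := by ring
    rw [e4]
    have hs : 0 ≤ (pp u x) ^ 2 := by positivity
    generalize (pp u x) ^ 2 = s at hs
    rcases hs.eq_or_lt with h | h
    · simp [← h]
    · have hl := Real.log_le_sub_one_of_pos (mul_pos h (Real.exp_pos (lam1 / θ₁ - 1)))
      rw [Real.log_mul h.ne' (Real.exp_pos _).ne', Real.log_exp] at hl
      have h3 := mul_le_mul_of_nonneg_left hl (mul_pos hθ₁ h).le
      have h4 : θ₁ * (lam1 / θ₁) = lam1 := by field_simp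
      linear_combination h3 - s * h4
  set A := ∫ x in Ω, (pp u x) ^ 4 with hA
  set B := ∫ x, (u x) ^ 4 with hB
  set C := μ₁ + θ₁ * Real.exp (lam1 / θ₁ - 1) with hC
  have hCp : 0 < C := by positivity
  rw [hG] at hNehari
  have hGC : (∫ x, gradSq u x) ≤ C * A := by rw [hC]; linarith
  rw [← Real.sqrt_eq_rpow] at hS
  have hSC : sobolevS ≤ C * Real.sqrt A := by
    rcases hA0.eq_or_lt with h | h
    · refine hS.trans ?_
      rw [← h] at hGC ⊢
      simp only [mul_zero, Real.sqrt_zero] at hGC ⊢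
      exact div_nonpos_of_nonpos_of_nonneg hGC (Real.sqrt_nonneg _)
    · have hq : 0 < Real.sqrt A := Real.sqrt_pos.2 h
      calc sobolevS ≤ _ := hS
        _ ≤ (C * A) / Real.sqrt B := by gcongr
        _ ≤ (C * A) / Real.sqrt A := by gcongr
        _ = C * Real.sqrt A := by rw [mul_div_assoc, Real.div_sqrt]
  rw [ge_iff_le, div_le_iff₀ (by positivity)]
  calc sobolevS ^ 2 ≤ (C * Real.sqrt A) ^ 2 := by gcongr
    _ = A * C ^ 2 := by rw [mul_pow, Real.sq_sqrt hA0]; ring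
end
end

section
/- Let Ω be a nonempty bounded open subset of ℝ⁴, let λ₁, λ₂ ∈ ℝ, μ₁, μ₂ > 0, θ₁, θ₂ > 0, and let β₁ := min{ μ₁, μ₂, √μ₁/(2√(2(μ₁⁻¹+μ₂⁻¹))), √μ₂/(2√(2(μ₁⁻¹+μ₂⁻¹))) }. Suppose 0 < β < β₁ and u, v ∈ C_c^∞(Ω) with u ≢ 0 and v ≢ 0 satisfy both Nehari identities ∫_Ω|∇u|² = λ₁∫_Ω(u⁺)² + μ₁∫_Ω(u⁺)⁴ + β∫_Ω(u⁺)²(v⁺)² + θ₁∫_Ω(u⁺)²log((u⁺)²) and ∫_Ω|∇v|² = λ₂∫_Ω(v⁺)² + μ₂∫_Ω(v⁺)⁴ + β∫_Ω(u⁺)²(v⁺)² + θ₂∫_Ω(v⁺)²log((v⁺)²), together with the energy bound ℒ(u,v) ≤ ½(μ₁⁻¹+μ₂⁻¹)S². Then ∫_Ω(u⁺)⁴ ≤ 2μ₁⁻¹(μ₁⁻¹+μ₂⁻¹)S², ∫_Ω(v⁺)⁴ ≤ 2μ₂⁻¹(μ₁⁻¹+μ₂⁻¹)S², ∫_Ω(u⁺)⁴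 ≥ S²/(4(μ₁+θ₁e^{λ₁/θ₁−1})²) and ∫_Ω(v⁺)⁴ ≥ S²/(4(μ₂+θ₂e^{λ₂/θ₂−1})²). -/
open MeasureTheory

noncomputable section

lemma pp_cont {u : E4 → ℝ} (h : Continuous u) : Continuous (pp u) := by
  unfold pp; fun_prop

lemma pp_nonneg' (u : E4 → ℝ) (x : E4) : 0 ≤ pp u x := le_max_right _ _

lemma pp_zero {u : E4 → ℝ} {x : E4} (h : u x = 0) : pp u x = 0 := by simp [pp, h]

/-- Continuous functions vanishing where `u` does are integrable. -/
lemma int_of {Ω : Set E4} {u : E4 → ℝ} (hu : TestFun Ω u) {f : E4 → ℝ} (hf : Continuous f)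
    (h0 : ∀ x, u x = 0 → f x = 0) : Integrable f := by
  refine hf.integrable_of_hasCompactSupport (hu.2.1.mono ?_)
  intro x hx hx'
  exact hx (h0 x hx')

lemma xlog_cont {p : E4 → ℝ} (h : Continuous p) :
    Continuous (fun x => (p x) ^ 2 * Real.log ((p x) ^ 2)) :=
  Real.continuous_mul_log.comp (h.pow 2)

lemma sob_nonneg : 0 ≤ sobolevS := by
  apply Real.sInf_nonneg
  rintro r ⟨w, -, -, -, rfl⟩
  apply div_nonneg
  · exact integral_nonneg fun x => sq_nonneg _
  · exact Real.rpow_nonneg (integral_nonneg fun x => by positivity) _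

lemma sob_le {Ω : Set E4} {u : E4 → ℝ} (hu : TestFun Ω u) (hne : u ≠ 0) :
    0 < (∫ x in Ω, (u x) ^ 4) ∧
    sobolevS * Real.sqrt (∫ x in Ω, (u x) ^ 4) ≤ ∫ x in Ω, gradSq u x := by
  have hc : Continuous u := hu.1.continuous
  have hout : ∀ x, x ∉ Ω → x ∉ tsupport u := fun x hx h => hx (hu.2.2 h)
  have e1 : (∫ x in Ω, (u x) ^ 4) = ∫ x, (u x) ^ 4 :=
    setIntegral_eq_integral_of_forall_compl_eq_zero fun x hx => by
      rw [image_eq_zero_of_notMem_tsupport (hout x hx)]; norm_num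
  have e2 : (∫ x in Ω, gradSq u x) = ∫ x, gradSq u x :=
    setIntegral_eq_integral_of_forall_compl_eq_zero fun x hx => by
      have : fderiv ℝ u x = 0 := by
        by_contra h
        exact hout x hx (support_fderiv_subset ℝ h)
      simp [gradSq, this]
  have hpos : 0 < ∫ x, (u x) ^ 4 := by
    obtain ⟨x, hx⟩ := Function.ne_iff.mp hne
    refine Continuous.integral_pos_of_hasCompactSupport_nonneg_nonzero (x := x) (hc.pow 4) ?_ ?_ ?_
    · refine hu.2.1.mono fun y hy hy' => hy ?_
      simp [hy']
    · intro y; show 0 ≤ u y ^ 4; positivity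
    · exact pow_ne_zero 4 hx
  rw [e1, e2]
  refine ⟨hpos, ?_⟩
  rw [← le_div_iff₀ (Real.sqrt_pos.mpr hpos)]
  refine csInf_le ⟨0, ?_⟩ ⟨u, hu.1, hu.2.1, hne, by rw [Real.sqrt_eq_rpow]⟩
  rintro r ⟨w, -, -, -, rfl⟩
  apply div_nonneg
  · exact integral_nonneg fun x => sq_nonneg _
  · exact Real.rpow_nonneg (integral_nonneg fun x => by positivity) _

lemma cs_pp {Ω : Set E4} {u v : E4 → ℝ} (hu : TestFun Ω u) (hv : TestFun Ω v) :
    (∫ x in Ω, (pp u x) ^ 2 * (pp v x) ^ 2) ^ 2 ≤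
      (∫ x in Ω, (pp u x) ^ 4) * (∫ x in Ω, (pp v x) ^ 4) := by
  have cu := pp_cont hu.1.continuous
  have cv := pp_cont hv.1.continuous
  have i1 : IntegrableOn (fun x => (pp u x) ^ 4) Ω :=
    (int_of hu (cu.pow 4) fun x h => by simp [pp_zero h]).integrableOn
  have i2 : IntegrableOn (fun x => (pp v x) ^ 4) Ω :=
    (int_of hv (cv.pow 4) fun x h => by simp [pp_zero h]).integrableOn
  have i3 : IntegrableOn (fun x => (pp u x) ^ 2 * (pp v x) ^ 2) Ω :=
    (int_of hu ((cu.pow 2).mul (cv.pow 2)) fun x h => by simp [pp_zero h]).integrableOn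
  have key : ∀ t : ℝ, 0 ≤ (∫ x in Ω, (pp u x) ^ 4) * (t * t) +
      (-2 * ∫ x in Ω, (pp u x) ^ 2 * (pp v x) ^ 2) * t + ∫ x in Ω, (pp v x) ^ 4 := by
    intro t
    have h : 0 ≤ ∫ x in Ω, ((t * t) * (pp u x) ^ 4 + (-2 * t) * ((pp u x) ^ 2 * (pp v x) ^ 2)
        + (pp v x) ^ 4) := by
      refine integral_nonneg fun x => ?_
      show 0 ≤ _
      nlinarith [sq_nonneg (t * (pp u x) ^ 2 - (pp v x) ^ 2)]
    have i13 : IntegrableOn (fun x => (t * t) * (pp u x) ^ 4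
        + (-2 * t) * ((pp u x) ^ 2 * (pp v x) ^ 2)) Ω := (i1.const_mul _).add (i3.const_mul _)
    rw [integral_add i13 i2,
      integral_add (i1.const_mul _) (i3.const_mul _), integral_const_mul, integral_const_mul] at h
    linarith
  have := discrim_le_zero key
  unfold discrim at this
  linarith

lemma pt_log {l θ s : ℝ} (hθ : 0 < θ) (hs : 0 ≤ s) :
    l * s + θ * (s * Real.log s) ≤ θ * Real.exp (l / θ - 1) * s ^ 2 := by
  rcases hs.eq_or_lt with rfl | hs
  · simp
  have h := Real.log_le_sub_one_of_pos (mul_pos hs (Real.exp_pos (l / θ - 1)))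
  rw [Real.log_mul hs.ne' (Real.exp_pos _).ne', Real.log_exp] at h
  have h2 : l / θ + Real.log s ≤ s * Real.exp (l / θ - 1) := by linarith
  have h3 := mul_le_mul_of_nonneg_left h2 (mul_pos hθ hs).le
  have h4 : θ * s * (l / θ + Real.log s) = l * s + θ * (s * Real.log s) := by
    field_simp
  rw [h4] at h3
  nlinarith

lemma lower {Ω : Set E4} {u v : E4 → ℝ} (hu : TestFun Ω u) (hv : TestFun Ω v) (hne : u ≠ 0)
    {l μ θ β : ℝ} (hμ : 0 < μ) (hθ : 0 < θ) (hβ : 0 < β)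
    (hN : (∫ x in Ω, gradSq u x) =
      l * (∫ x in Ω, (pp u x) ^ 2) + μ * (∫ x in Ω, (pp u x) ^ 4)
        + β * (∫ x in Ω, (pp u x) ^ 2 * (pp v x) ^ 2)
        + θ * (∫ x in Ω, (pp u x) ^ 2 * Real.log ((pp u x) ^ 2)))
    (hB : β ^ 2 * (∫ x in Ω, (pp v x) ^ 4) ≤ sobolevS ^ 2 / 4) :
    (∫ x in Ω, (pp u x) ^ 4) ≥
      sobolevS ^ 2 / (4 * (μ + θ * Real.exp (l / θ - 1)) ^ 2) := by
  have cu := pp_cont hu.1.continuous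
  have i4 : IntegrableOn (fun x => (pp u x) ^ 4) Ω :=
    (int_of hu (cu.pow 4) fun x h => by simp [pp_zero h]).integrableOn
  have iu : IntegrableOn (fun x => (u x) ^ 4) Ω :=
    (int_of hu (hu.1.continuous.pow 4) fun x h => by simp [h]).integrableOn
  have i2 : IntegrableOn (fun x => (pp u x) ^ 2) Ω :=
    (int_of hu (cu.pow 2) fun x h => by simp [pp_zero h]).integrableOn
  have il : IntegrableOn (fun x => (pp u x) ^ 2 * Real.log ((pp u x) ^ 2)) Ω :=
    (int_of hu (xlog_cont cu) fun x h => by simp [pp_zero h]).integrableOn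
  have hcs := cs_pp hu hv
  obtain ⟨hD, hS⟩ := sob_le hu hne
  have hS0 := sob_nonneg
  have hAD : (∫ x in Ω, (pp u x) ^ 4) ≤ ∫ x in Ω, (u x) ^ 4 := by
    refine integral_mono i4 iu fun x => ?_
    show (max (u x) 0) ^ 4 ≤ (u x) ^ 4
    rcases le_total (u x) 0 with h | h
    · rw [max_eq_right h]; simp only [ne_eq, OfNat.ofNat_ne_zero, not_false_eq_true, zero_pow]
      positivity
    · rw [max_eq_left h]
  have hlog : l * (∫ x in Ω, (pp u x) ^ 2) + θ * (∫ x in Ω, (pp u x) ^ 2 * Real.log ((pp u x) ^ 2))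
      ≤ θ * Real.exp (l / θ - 1) * ∫ x in Ω, (pp u x) ^ 4 := by
    rw [← integral_const_mul, ← integral_const_mul, ← integral_const_mul,
      ← integral_add (i2.const_mul _) (il.const_mul _)]
    refine integral_mono ((i2.const_mul _).add (il.const_mul _)) (i4.const_mul _) fun x => ?_
    have := pt_log (l := l) hθ (sq_nonneg (pp u x))
    rw [← pow_mul] at this
    exact this
  have hA0 : 0 ≤ ∫ x in Ω, (pp u x) ^ 4 := integral_nonneg fun x => by
    show 0 ≤ (pp u x) ^ 4
    positivity
  have hK : 0 < μ + θ * Real.exp (l / θ - 1) := by positivity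
  have hC0 : 0 ≤ ∫ x in Ω, (pp u x) ^ 2 * (pp v x) ^ 2 := integral_nonneg fun x => by
    show 0 ≤ (pp u x) ^ 2 * (pp v x) ^ 2
    positivity
  generalize (∫ x in Ω, (pp u x) ^ 4) = A at *
  generalize (∫ x in Ω, (pp v x) ^ 4) = B at *
  generalize (∫ x in Ω, (pp u x) ^ 2 * (pp v x) ^ 2) = C at *
  generalize (∫ x in Ω, (u x) ^ 4) = D at *
  generalize (∫ x in Ω, gradSq u x) = G at *
  generalize sobolevS = S at *
  set K := μ + θ * Real.exp (l / θ - 1) with hKdef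
  have hsA := Real.sq_sqrt hA0
  have ha0 := Real.sqrt_nonneg A
  have haD : Real.sqrt A ≤ Real.sqrt D := Real.sqrt_le_sqrt hAD
  have hd := Real.sqrt_pos.mpr hD
  set a := Real.sqrt A
  set d := Real.sqrt D
  have hbc : β * C ≤ a * S / 2 := by
    apply le_of_sq_le_sq _ (by positivity)
    calc (β * C) ^ 2 = β ^ 2 * C ^ 2 := by ring
      _ ≤ β ^ 2 * (A * B) := by gcongr
      _ = A * (β ^ 2 * B) := by ring
      _ ≤ A * (S ^ 2 / 4) := by gcongr
      _ = (a * S / 2) ^ 2 := by rw [← hsA]; ring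
  have hmain : S * d ≤ K * a ^ 2 + a * S / 2 := by
    rw [hsA, hKdef, add_mul]; linarith
  have hfin : S / 2 ≤ K * a := by
    rcases ha0.eq_or_lt with h | h
    · rw [← h] at hmain ⊢
      have : S * d ≤ 0 := by linarith
      nlinarith
    · have h1 : S * a ≤ S * d := by gcongr
      have : (S / 2) * a ≤ (K * a) * a := by nlinarith
      exact le_of_mul_le_mul_right this h
  rw [ge_iff_le, div_le_iff₀ (by positivity), ← hsA]
  have := mul_self_le_mul_self (by positivity) hfin
  nlinarith

lemma beta_aux {β μ m S B : ℝ} (hβ : 0 < β) (hμ : 0 < μ) (hm : 0 < m)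
    (h : β < Real.sqrt μ / (2 * Real.sqrt (2 * m))) (hB : B ≤ 2 * μ⁻¹ * m * S ^ 2) :
    β ^ 2 * B ≤ S ^ 2 / 4 := by
  have h1 : β ^ 2 ≤ μ / (8 * m) := by
    calc β ^ 2 ≤ (Real.sqrt μ / (2 * Real.sqrt (2 * m))) ^ 2 := by gcongr
      _ = μ / (8 * m) := by
        rw [div_pow, mul_pow, Real.sq_sqrt hμ.le, Real.sq_sqrt (by positivity)]; ring_nf
  calc β ^ 2 * B ≤ β ^ 2 * (2 * μ⁻¹ * m * S ^ 2) := by gcongr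
    _ ≤ μ / (8 * m) * (2 * μ⁻¹ * m * S ^ 2) := by gcongr
    _ = S ^ 2 / 4 := by field_simp; ring

/-- Lemma 2.1 of the paper, case `0 < β < β₁`: both Nehari identities together with the
energy bound `ℒ(u,v) ≤ ½(μ₁⁻¹+μ₂⁻¹)S²` yield two-sided `L⁴` bounds on `u⁺` and `v⁺`. -/
theorem stmt_5 (Ω : Set E4) (hΩne : Ω.Nonempty) (hΩo : IsOpen Ω)
    (hΩb : Bornology.IsBounded Ω)
    (lam1 lam2 μ₁ μ₂ θ₁ θ₂ β : ℝ) (hμ₁ : 0 < μ₁) (hμ₂ : 0 < μ₂)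
    (hθ₁ : 0 < θ₁) (hθ₂ : 0 < θ₂)
    (hβ0 : 0 < β)
    (hβ1 : β < min (min μ₁ μ₂)
      (min (Real.sqrt μ₁ / (2 * Real.sqrt (2 * (μ₁⁻¹ + μ₂⁻¹))))
           (Real.sqrt μ₂ / (2 * Real.sqrt (2 * (μ₁⁻¹ + μ₂⁻¹))))))
    (u v : E4 → ℝ) (hu : TestFun Ω u) (hv : TestFun Ω v)
    (hune : u ≠ 0) (hvne : v ≠ 0)
    (hNehariU : (∫ x in Ω, gradSq u x) =
      lam1 * (∫ x in Ω, (pp u x) ^ 2) + μ₁ * (∫ x in Ω, (pp u x) ^ 4)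
        + β * (∫ x in Ω, (pp u x) ^ 2 * (pp v x) ^ 2)
        + θ₁ * (∫ x in Ω, (pp u x) ^ 2 * Real.log ((pp u x) ^ 2)))
    (hNehariV : (∫ x in Ω, gradSq v x) =
      lam2 * (∫ x in Ω, (pp v x) ^ 2) + μ₂ * (∫ x in Ω, (pp v x) ^ 4)
        + β * (∫ x in Ω, (pp u x) ^ 2 * (pp v x) ^ 2)
        + θ₂ * (∫ x in Ω, (pp v x) ^ 2 * Real.log ((pp v x) ^ 2)))
    (hEnergy : LL Ω lam1 μ₁ θ₁ lam2 μ₂ θ₂ β u v ≤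
      (1 / 2) * (μ₁⁻¹ + μ₂⁻¹) * sobolevS ^ 2) :
    (∫ x in Ω, (pp u x) ^ 4) ≤ 2 * μ₁⁻¹ * (μ₁⁻¹ + μ₂⁻¹) * sobolevS ^ 2 ∧
    (∫ x in Ω, (pp v x) ^ 4) ≤ 2 * μ₂⁻¹ * (μ₁⁻¹ + μ₂⁻¹) * sobolevS ^ 2 ∧
    (∫ x in Ω, (pp u x) ^ 4) ≥
      sobolevS ^ 2 / (4 * (μ₁ + θ₁ * Real.exp (lam1 / θ₁ - 1)) ^ 2) ∧
    (∫ x in Ω, (pp v x) ^ 4) ≥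
      sobolevS ^ 2 / (4 * (μ₂ + θ₂ * Real.exp (lam2 / θ₂ - 1)) ^ 2) := by
  have hm : 0 < μ₁⁻¹ + μ₂⁻¹ := by positivity
  have split : ∀ w : E4 → ℝ, TestFun Ω w →
      (∫ x in Ω, (pp w x) ^ 2 * (Real.log ((pp w x) ^ 2) - 1)) =
      (∫ x in Ω, (pp w x) ^ 2 * Real.log ((pp w x) ^ 2)) - ∫ x in Ω, (pp w x) ^ 2 := by
    intro w hw
    have cw := pp_cont hw.1.continuous
    rw [← integral_sub]
    · simp only [mul_sub, mul_one]
    · exact (int_of hw (xlog_cont cw) fun x h => by simp [pp_zero h]).integrableOn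
    · exact (int_of hw (cw.pow 2) fun x h => by simp [pp_zero h]).integrableOn
  have nn : ∀ (w : E4 → ℝ) (n : ℕ), 0 ≤ ∫ x in Ω, (pp w x) ^ n := fun w n =>
    integral_nonneg fun x => pow_nonneg (pp_nonneg' w x) n
  have hC0 : 0 ≤ ∫ x in Ω, (pp u x) ^ 2 * (pp v x) ^ 2 := integral_nonneg fun x => by
    show 0 ≤ (pp u x) ^ 2 * (pp v x) ^ 2
    positivity
  unfold LL at hEnergy
  rw [split u hu, split v hv] at hEnergy
  have a1 := mul_nonneg hμ₁.le (nn u 4)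
  have a2 := mul_nonneg hμ₂.le (nn v 4)
  have a3 := mul_nonneg hθ₁.le (nn u 2)
  have a4 := mul_nonneg hθ₂.le (nn v 2)
  have a5 := mul_nonneg hβ0.le hC0
  have hU : (∫ x in Ω, (pp u x) ^ 4) ≤ 2 * μ₁⁻¹ * (μ₁⁻¹ + μ₂⁻¹) * sobolevS ^ 2 := by
    have : μ₁ * (∫ x in Ω, (pp u x) ^ 4) ≤ 2 * (μ₁⁻¹ + μ₂⁻¹) * sobolevS ^ 2 := by linarith
    rw [← le_div_iff₀' hμ₁] at this
    refine this.trans (le_of_eq ?_)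
    rw [div_eq_mul_inv]; ring
  have hV : (∫ x in Ω, (pp v x) ^ 4) ≤ 2 * μ₂⁻¹ * (μ₁⁻¹ + μ₂⁻¹) * sobolevS ^ 2 := by
    have : μ₂ * (∫ x in Ω, (pp v x) ^ 4) ≤ 2 * (μ₁⁻¹ + μ₂⁻¹) * sobolevS ^ 2 := by linarith
    rw [← le_div_iff₀' hμ₂] at this
    refine this.trans (le_of_eq ?_)
    rw [div_eq_mul_inv]; ring
  have b := (lt_min_iff.mp hβ1).2
  have b1 := (lt_min_iff.mp b).1
  have b2 := (lt_min_iff.mp b).2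
  refine ⟨hU, hV, lower hu hv hune hμ₁ hθ₁ hβ0 hNehariU (beta_aux hβ0 hμ₂ hm b2 hV),
    lower hv hu hvne hμ₂ hθ₂ hβ0 ?_ (beta_aux hβ0 hμ₁ hm b1 hU)⟩
  simp only [mul_comm ((pp v _) ^ 2) ((pp u _) ^ 2)]
  exact hNehariV
end
end

section
/- Let Ω be a nonempty bounded open subset of ℝ⁴, let λ ∈ ℝ, μ > 0 and θ > 0. Suppose u ∈ C_c^∞(Ω) with u ≢ 0 satisfies the Nehari identity ∫_Ω|∇u|² = λ∫_Ω(u⁺)² + μ∫_Ω(u⁺)⁴ + θ∫_Ω(u⁺)²log((u⁺)²). Then the energy J(u) := (1/2)∫_Ω|∇u|² − (λ/2)∫_Ω(u⁺)² − (μ/4)∫_Ω(u⁺)⁴ − (θ/2)∫_Ω(u⁺)²(log((u⁺)²)−1) satisfies J(u) ≥ μS²/(4(μ + θe^{λ/θ−1})²). In particular, the infimum C_θ of J over all such u satisfies C_θ ≥ μS²/(4(μ + θe^{λ/θ−1})²). -/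
open MeasureTheory

noncomputable section

/-- The modified energy functional `J` for the single equation. -/
def JJ (Ω : Set E4) (lam μ θ : ℝ) (u : E4 → ℝ) : ℝ :=
  (1 / 2) * (∫ x in Ω, gradSq u x) - (lam / 2) * (∫ x in Ω, (pp u x) ^ 2)
    - (μ / 4) * (∫ x in Ω, (pp u x) ^ 4)
    - (θ / 2) * (∫ x in Ω, (pp u x) ^ 2 * (Real.log ((pp u x) ^ 2) - 1))

/-- The Nehari identity for the single equation. -/
def NehariEq (Ω : Set E4) (lam μ θ : ℝ) (u : E4 → ℝ) : Prop :=
  (∫ x in Ω, gradSq u x) =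
    lam * (∫ x in Ω, (pp u x) ^ 2) + μ * (∫ x in Ω, (pp u x) ^ 4)
      + θ * (∫ x in Ω, (pp u x) ^ 2 * Real.log ((pp u x) ^ 2))

theorem stmt_6_aux (Ω : Set E4) (lam μ θ : ℝ) (hμ : 0 < μ) (hθ : 0 < θ)
    (u : E4 → ℝ) (hu : TestFun Ω u) (h0 : u ≠ 0) (hN : NehariEq Ω lam μ θ u) :
    JJ Ω lam μ θ u ≥ μ * sobolevS ^ 2 / (4 * (μ + θ * Real.exp (lam / θ - 1)) ^ 2) := by
  obtain ⟨hsm, hcs, hsub⟩ := hu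
  have hc : Continuous u := hsm.continuous
  have hpc : Continuous (pp u) := by unfold pp; fun_prop
  have hpz : ∀ x, u x = 0 → pp u x = 0 := fun x hx => by simp [pp, hx]
  have mkc : ∀ F : ℝ → ℝ, F 0 = 0 → Continuous F → Integrable (fun x => F (pp u x)) := by
    intro F hF0 hF
    refine (hF.comp hpc).integrable_of_hasCompactSupport ?_
    refine hcs.mono ?_
    intro x hx hx0
    exact hx (by simp [hpz x hx0, hF0])
  have i2 : Integrable (fun x => (pp u x) ^ 2) := mkc (fun t => t ^ 2) (by simp) (by fun_prop)
  have i4 : Integrable (fun x => (pp u x) ^ 4) := mkc (fun t => t ^ 4) (by simp) (by fun_prop)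
  have il : Integrable (fun x => (pp u x) ^ 2 * Real.log ((pp u x) ^ 2)) :=
    mkc (fun t => t ^ 2 * Real.log (t ^ 2)) (by simp)
      (Real.continuous_mul_log.comp (continuous_pow 2))
  have iu : Integrable (fun x => (u x) ^ 4) := by
    refine (hc.pow 4).integrable_of_hasCompactSupport (hcs.mono ?_)
    intro x hx hx0
    exact hx (by simp [hx0])
  have hout : ∀ x, x ∉ Ω → u x = 0 := fun x hx =>
    image_eq_zero_of_notMem_tsupport (fun h => hx (hsub h))
  have eg : (∫ x in Ω, gradSq u x) = ∫ x, gradSq u x := by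
    refine setIntegral_eq_integral_of_forall_compl_eq_zero ?_
    intro x hx
    have : fderiv ℝ u x = 0 := by
      by_contra h
      exact hx (hsub (support_fderiv_subset ℝ h))
    simp [gradSq, this]
  have e4 : (∫ x in Ω, (pp u x) ^ 4) = ∫ x, (pp u x) ^ 4 := by
    refine setIntegral_eq_integral_of_forall_compl_eq_zero ?_
    intro x hx
    simp [hpz x (hout x hx)]
  have hlog : (∫ x in Ω, (pp u x) ^ 2 * (Real.log ((pp u x) ^ 2) - 1)) =
      (∫ x in Ω, (pp u x) ^ 2 * Real.log ((pp u x) ^ 2)) - ∫ x in Ω, (pp u x) ^ 2 := by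
    rw [← integral_sub il.integrableOn i2.integrableOn]
    congr 1
    ext x
    ring
  set K := μ + θ * Real.exp (lam / θ - 1) with hK
  have hKpos : 0 < K := by positivity
  set A := ∫ x, (pp u x) ^ 4 with hA
  set B := ∫ x, (u x) ^ 4 with hB
  have hA0 : 0 ≤ A := integral_nonneg fun x => by positivity
  have hP0 : 0 ≤ ∫ x in Ω, (pp u x) ^ 2 := integral_nonneg fun x => by positivity
  have hAB : A ≤ B := by
    refine integral_mono i4 iu fun x => ?_
    simp only [pp]
    rcases le_total (u x) 0 with h | h
    · rw [max_eq_right h, zero_pow (by norm_num)]; exact (by decide : Even 4).pow_nonneg (u x)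
    · simp [max_eq_left h]
  have hBpos : 0 < B := by
    obtain ⟨x, hx⟩ := Function.ne_iff.mp h0
    refine (hc.pow 4).integral_pos_of_hasCompactSupport_nonneg_nonzero
      (hcs.mono ?_) (fun x => ?_) (x := x) ?_
    · intro y hy hy0
      exact hy (by simp [hy0])
    · show (0:ℝ) ≤ (u x) ^ 4
      positivity
    · exact pow_ne_zero 4 hx
  have hJ : JJ Ω lam μ θ u = μ / 4 * A + θ / 2 * ∫ x in Ω, (pp u x) ^ 2 := by
    unfold NehariEq at hN
    unfold JJ
    rw [hlog, hN, e4]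
    ring
  have hG : (∫ x, gradSq u x) ≤ K * A := by
    have hpt : ∀ x, lam * (pp u x) ^ 2 + μ * (pp u x) ^ 4
        + θ * ((pp u x) ^ 2 * Real.log ((pp u x) ^ 2)) ≤ K * (pp u x) ^ 4 := by
      intro x
      set t := pp u x
      rcases eq_or_ne t 0 with h | h
      · simp [h]
      have ht : 0 < t ^ 2 := by positivity
      have h1 := Real.add_one_le_exp (lam / θ + Real.log (t ^ 2) - 1)
      have h2 : Real.exp (lam / θ + Real.log (t ^ 2) - 1) = Real.exp (lam / θ - 1) * t ^ 2 := by
        rw [show lam / θ + Real.log (t ^ 2) - 1 = (lam / θ - 1) + Real.log (t ^ 2) by ring,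
          Real.exp_add, Real.exp_log ht]
      rw [h2] at h1
      have h3 : lam + θ * Real.log (t ^ 2) ≤ θ * (Real.exp (lam / θ - 1) * t ^ 2) := by
        have := mul_le_mul_of_nonneg_left h1 hθ.le
        have h4 : θ * (lam / θ) = lam := by field_simp
        nlinarith
      have := mul_le_mul_of_nonneg_left h3 ht.le
      rw [hK]
      nlinarith
    have i24 : Integrable (fun x => lam * (pp u x) ^ 2 + μ * (pp u x) ^ 4) :=
      (i2.const_mul _).add (i4.const_mul _)
    rw [← eg, hN, ← e4, ← integral_const_mul, ← integral_const_mul, ← integral_const_mul,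
      ← integral_const_mul,
      ← integral_add (i2.const_mul _).integrableOn (i4.const_mul _).integrableOn,
      ← integral_add i24.integrableOn
        (il.const_mul _).integrableOn]
    exact integral_mono (i24.add (il.const_mul _)).integrableOn
      (i4.const_mul _).integrableOn hpt
  have hSnn : ∀ r ∈ { r : ℝ | ∃ w : E4 → ℝ, ContDiff ℝ (⊤ : ℕ∞) w ∧ HasCompactSupport w ∧ w ≠ 0 ∧
      r = (∫ x, gradSq w x) / (∫ x, (w x) ^ 4) ^ ((1 : ℝ) / 2) }, 0 ≤ r := by
    rintro r ⟨w, -, -, -, rfl⟩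
    refine div_nonneg (integral_nonneg fun x => ?_) (Real.rpow_nonneg (integral_nonneg fun x => ?_) _)
    · show 0 ≤ ‖fderiv ℝ w x‖ ^ 2
      positivity
    · show 0 ≤ (w x) ^ 4
      positivity
  have hS0 : 0 ≤ sobolevS := Real.sInf_nonneg hSnn
  have hS : sobolevS ≤ (∫ x, gradSq u x) / B ^ ((1 : ℝ) / 2) :=
    csInf_le ⟨0, hSnn⟩ ⟨u, hsm, hcs, h0, rfl⟩
  rw [← Real.sqrt_eq_rpow, le_div_iff₀ (Real.sqrt_pos.mpr hBpos)] at hS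
  have h5 : (sobolevS * √B) ^ 2 ≤ (K * A) ^ 2 :=
    pow_le_pow_left₀ (mul_nonneg hS0 (Real.sqrt_nonneg _)) (hS.trans hG) 2
  rw [mul_pow, Real.sq_sqrt hBpos.le] at h5
  have h6 : sobolevS ^ 2 ≤ K ^ 2 * A := by
    refine le_of_mul_le_mul_right (h5.trans ?_) hBpos
    have := mul_le_mul_of_nonneg_left hAB (by positivity : 0 ≤ K ^ 2 * A)
    nlinarith
  rw [hJ, ge_iff_le, div_le_iff₀ (by positivity)]
  have h7 := mul_le_mul_of_nonneg_left h6 hμ.le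
  have h8 : 0 ≤ (θ / 2 * ∫ x in Ω, (pp u x) ^ 2) * (4 * K ^ 2) := by positivity
  nlinarith

/-- Lower bound of Proposition 2.4: on the Nehari set of the single logarithmic
Brézis–Nirenberg equation one has `J(u) ≥ μS²/(4(μ + θe^{λ/θ−1})²)`; in particular this
value is a lower bound for the corresponding energy level `C_θ`. -/
theorem stmt_6 (Ω : Set E4) (hΩne : Ω.Nonempty) (hΩo : IsOpen Ω)
    (hΩb : Bornology.IsBounded Ω)
    (lam μ θ : ℝ) (hμ : 0 < μ) (hθ : 0 < θ) :
    (∀ u : E4 → ℝ, TestFun Ω u → u ≠ 0 → NehariEq Ω lam μ θ u →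
      JJ Ω lam μ θ u ≥ μ * sobolevS ^ 2 / (4 * (μ + θ * Real.exp (lam / θ - 1)) ^ 2)) ∧
    (μ * sobolevS ^ 2 / (4 * (μ + θ * Real.exp (lam / θ - 1)) ^ 2) ∈
      lowerBounds { r : ℝ | ∃ u : E4 → ℝ, TestFun Ω u ∧ u ≠ 0 ∧
        NehariEq Ω lam μ θ u ∧ r = JJ Ω lam μ θ u }) := by
  have key : ∀ u : E4 → ℝ, TestFun Ω u → u ≠ 0 → NehariEq Ω lam μ θ u →
      JJ Ω lam μ θ u ≥ μ * sobolevS ^ 2 / (4 * (μ + θ * Real.exp (lam / θ - 1)) ^ 2) :=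
    fun u hu h0 hN => stmt_6_aux Ω lam μ θ hμ hθ u hu h0 hN
  refine ⟨key, ?_⟩
  rintro r ⟨u, hu, h0, hN, rfl⟩
  exact key u hu h0 hN
end
end

section
/- Let λ₁, λ₂ ∈ ℝ, μ₁, μ₂ > 0, θ₁, θ₂ > 0, and set Λ := min{ μ₁/(μ₁+θ₁e^{λ₁/θ₁−1})², μ₂/(μ₂+θ₂e^{λ₂/θ₂−1})² }. Then 0 < Λ < min{μ₁⁻¹, μ₂⁻¹}; the quadratic equation β² − (2/Λ)β + (μ₁+μ₂)/Λ − μ₁μ₂ = 0 has two real roots, and its larger root β₂ = 1/Λ + √((1/Λ − μ₁)(1/Λ − μ₂)) satisfies β₂ > max{μ₁, μ₂}; moreover, for every β > β₂ one has β² > μ₁μ₂ and Λ > (2β − μ₁ − μ₂)/(β² − μ₁μ₂). -/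
theorem aux_lt (m t : ℝ) (hm : 0 < m) (ht : 0 < t) : m / (m + t) ^ 2 < m⁻¹ := by
  rw [inv_eq_one_div, div_lt_div_iff₀ (by positivity) hm]
  nlinarith [mul_pos hm ht, mul_pos ht ht]

/-- Algebraic content of Theorem 1.1(3) and Proposition 3.3: with
`Λ := min{ μ₁/(μ₁+θ₁e^{λ₁/θ₁−1})², μ₂/(μ₂+θ₂e^{λ₂/θ₂−1})² }` one has
`0 < Λ < min{μ₁⁻¹, μ₂⁻¹}`; the quadratic `β² − (2/Λ)β + (μ₁+μ₂)/Λ − μ₁μ₂ = 0` has two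
real roots, its larger root `β₂ = 1/Λ + √((1/Λ−μ₁)(1/Λ−μ₂))` satisfies
`β₂ > max{μ₁, μ₂}`, and for every `β > β₂` one has `β² > μ₁μ₂` and
`Λ > (2β−μ₁−μ₂)/(β²−μ₁μ₂)`. -/
theorem stmt_7 (lam1 lam2 μ₁ μ₂ θ₁ θ₂ : ℝ) (hμ₁ : 0 < μ₁) (hμ₂ : 0 < μ₂)
    (hθ₁ : 0 < θ₁) (hθ₂ : 0 < θ₂) :
    let Λ : ℝ := min (μ₁ / (μ₁ + θ₁ * Real.exp (lam1 / θ₁ - 1)) ^ 2)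
      (μ₂ / (μ₂ + θ₂ * Real.exp (lam2 / θ₂ - 1)) ^ 2)
    let β₂ : ℝ := 1 / Λ + Real.sqrt ((1 / Λ - μ₁) * (1 / Λ - μ₂))
    let β₂' : ℝ := 1 / Λ - Real.sqrt ((1 / Λ - μ₁) * (1 / Λ - μ₂))
    0 < Λ ∧ Λ < min μ₁⁻¹ μ₂⁻¹ ∧
    β₂ ^ 2 - (2 / Λ) * β₂ + (μ₁ + μ₂) / Λ - μ₁ * μ₂ = 0 ∧
    β₂' ^ 2 - (2 / Λ) * β₂' + (μ₁ + μ₂) / Λ - μ₁ * μ₂ = 0 ∧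
    β₂' < β₂ ∧
    β₂ > max μ₁ μ₂ ∧
    ∀ β : ℝ, β > β₂ → β ^ 2 > μ₁ * μ₂ ∧ Λ > (2 * β - μ₁ - μ₂) / (β ^ 2 - μ₁ * μ₂) := by
  intro Λ β₂ β₂'
  have e1 : 0 < θ₁ * Real.exp (lam1 / θ₁ - 1) := by positivity
  have e2 : 0 < θ₂ * Real.exp (lam2 / θ₂ - 1) := by positivity
  have h0 : 0 < Λ := lt_min (by positivity) (by positivity)
  have h1 : Λ < μ₁⁻¹ := lt_of_le_of_lt (min_le_left _ _) (aux_lt _ _ hμ₁ e1)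
  have h2 : Λ < μ₂⁻¹ := lt_of_le_of_lt (min_le_right _ _) (aux_lt _ _ hμ₂ e2)
  clear_value Λ
  have hx1 : μ₁ < 1 / Λ := by rw [one_div]; exact (lt_inv_comm₀ h0 hμ₁).1 h1
  have hx2 : μ₂ < 1 / Λ := by rw [one_div]; exact (lt_inv_comm₀ h0 hμ₂).1 h2
  have d2 : 2 / Λ = 2 * (1 / Λ) := by ring
  have d3 : (μ₁ + μ₂) / Λ = (μ₁ + μ₂) * (1 / Λ) := by ring
  have hΛx : Λ * (1 / Λ) = 1 := by field_simp
  rw [d2, d3]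
  simp only [β₂, β₂']
  clear β₂ β₂'
  generalize 1 / Λ = x at *
  have hp : 0 < (x - μ₁) * (x - μ₂) := mul_pos (by linarith) (by linarith)
  have hs := Real.sqrt_pos.2 hp
  have hs2 := Real.sq_sqrt hp.le
  generalize Real.sqrt ((x - μ₁) * (x - μ₂)) = s at *
  refine ⟨h0, lt_min h1 h2, by linear_combination hs2, by linear_combination hs2,
    by linarith, max_lt (by linarith) (by linarith), fun β hβ => ?_⟩
  have hb : β ^ 2 > μ₁ * μ₂ := by
    have := mul_lt_mul'' (show μ₁ < β by linarith) (show μ₂ < β by linarith) hμ₁.le hμ₂.le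
    nlinarith
  refine ⟨hb, ?_⟩
  rw [gt_iff_lt, div_lt_iff₀ (by linarith)]
  have h3 : x * (2 * β - μ₁ - μ₂) < β ^ 2 - μ₁ * μ₂ := by
    nlinarith [mul_pos (show 0 < β - x - s by linarith) (show 0 < β - x + s by linarith)]
  have h4 := mul_lt_mul_of_pos_left h3 h0
  rwa [← mul_assoc, hΛx, one_mul] at h4
end

section
/- Let μ₁, μ₂ > 0 and 0 < β < min{μ₁, μ₂}, and let (k, l) be the unique solution of μ₁k + βl = 1, βk + μ₂l = 1 (so k, l > 0). Define g(t₁, t₂) := (1/2)(k·t₁² + l·t₂²) − (1/4)(μ₁k²t₁⁴ + 2βkl·t₁²t₂² + μ₂l²t₂⁴) for t₁, t₂ ≥ 0. Then for all t₁, t₂ ≥ 0 one has g(t₁, t₂) ≤ g(1, 1) = (1/4)(k + l). -/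
/-- Maximization claim from Proposition 2.7: for `0 < β < min{μ₁,μ₂}` and `(k,l)` the
solution of `μ₁k + βl = 1`, `βk + μ₂l = 1`, the function
`g(t₁,t₂) = ½(k t₁² + l t₂²) − ¼(μ₁k²t₁⁴ + 2βkl t₁²t₂² + μ₂l²t₂⁴)` satisfies
`g(t₁,t₂) ≤ g(1,1) = ¼(k+l)` for all `t₁, t₂ ≥ 0`. -/
theorem stmt_9 (μ₁ μ₂ β k l : ℝ) (hμ₁ : 0 < μ₁) (hμ₂ : 0 < μ₂)
    (hβ0 : 0 < β) (hβ : β < min μ₁ μ₂)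
    (hk : μ₁ * k + β * l = 1) (hl : β * k + μ₂ * l = 1) :
    let g : ℝ → ℝ → ℝ := fun t₁ t₂ =>
      (1 / 2) * (k * t₁ ^ 2 + l * t₂ ^ 2) -
      (1 / 4) * (μ₁ * k ^ 2 * t₁ ^ 4 + 2 * β * k * l * t₁ ^ 2 * t₂ ^ 2 + μ₂ * l ^ 2 * t₂ ^ 4)
    (∀ t₁ t₂ : ℝ, 0 ≤ t₁ → 0 ≤ t₂ → g t₁ t₂ ≤ g 1 1) ∧ g 1 1 = (1 / 4) * (k + l) := by
  intro g
  have h1 : β < μ₁ := lt_of_lt_of_le hβ (min_le_left _ _)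
  have h2 : β < μ₂ := lt_of_lt_of_le hβ (min_le_right _ _)
  refine ⟨?_, ?_⟩
  · intro t₁ t₂ _ _
    have e : g 1 1 - g t₁ t₂ = (1 / 4) * ((μ₁ - β) * (k * (t₁ ^ 2 - 1)) ^ 2
        + β * (k * (t₁ ^ 2 - 1) + l * (t₂ ^ 2 - 1)) ^ 2
        + (μ₂ - β) * (l * (t₂ ^ 2 - 1)) ^ 2) := by
      simp only [g]
      linear_combination (1 / 2) * (k * (t₁ ^ 2 - 1)) * hk + (1 / 2) * (l * (t₂ ^ 2 - 1)) * hl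
    have a1 := mul_nonneg (sub_pos.2 h1).le (sq_nonneg (k * (t₁ ^ 2 - 1)))
    have a2 := mul_nonneg hβ0.le (sq_nonneg (k * (t₁ ^ 2 - 1) + l * (t₂ ^ 2 - 1)))
    have a3 := mul_nonneg (sub_pos.2 h2).le (sq_nonneg (l * (t₂ ^ 2 - 1)))
    linarith
  · simp only [g]
    linear_combination (-1 / 4) * k * hk + (-1 / 4) * l * hl
end

section
/- Let Ω be a nonempty bounded open subset of ℝ⁴, let λ₁, λ₂ ∈ ℝ, μ₁, μ₂ > 0, θ₁, θ₂ > 0 and β > max{μ₁, μ₂}. Then the functional ℒ has a mountain pass geometry on pairs of C_c^∞(Ω) functions: (i) there exist α > 0 and ζ > 0 such that ℒ(u,v) ≥ α for all u, v ∈ C_c^∞(Ω) with (∫_Ω|∇u|² + ∫_Ω|∇v|²)^{1/2} = ζ; (ii) there exist w, z ∈ C_c^∞(Ω) with (∫_Ω|∇w|² + ∫_Ω|∇z|²)^{1/2} ≥ ζ and ℒ(w, z) < 0. -/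
open MeasureTheory

noncomputable section

lemma aux_sobolev (Ω : Set E4) : ∃ K : ℝ, 0 ≤ K ∧ ∀ u : E4 → ℝ, TestFun Ω u →
    (∫ x in Ω, (u x) ^ 4) ≤ K * (∫ x in Ω, gradSq u x) ^ 2 := by
  set C := eLpNormLESNormFDerivOfEqInnerConst (volume : Measure E4) ((2 : NNReal) : ℝ) with hC
  refine ⟨(C : ℝ) ^ 4, by positivity, ?_⟩
  rintro u ⟨hu, hc, hs⟩
  have hu1 : ContDiff ℝ 1 u := hu.of_le (by exact_mod_cast le_top)
  have e1 : (∫ x in Ω, (u x) ^ 4) = ∫ x, (u x) ^ 4 := by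
    apply setIntegral_eq_integral_of_forall_compl_eq_zero
    intro x hx
    rw [image_eq_zero_of_notMem_tsupport (fun h => hx (hs h))]; norm_num
  have e2 : (∫ x in Ω, gradSq u x) = ∫ x, ‖fderiv ℝ u x‖ ^ 2 := by
    apply setIntegral_eq_integral_of_forall_compl_eq_zero
    intro x hx
    unfold gradSq
    rw [fderiv_of_notMem_tsupport (𝕜 := ℝ) (fun h => hx (hs h))]; simp
  have key := eLpNorm_le_eLpNorm_fderiv_of_eq_inner (volume : Measure E4) hu1 hc
    (p := 2) (p' := 4) (by norm_num) (by simp) (by simp; norm_num)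
  have m1 : MemLp u ((4 : NNReal) : ENNReal) volume := hu.continuous.memLp_of_hasCompactSupport hc
  have m2 : MemLp (fderiv ℝ u) ((2 : NNReal) : ENNReal) volume :=
    (hu1.continuous_fderiv (by norm_num)).memLp_of_hasCompactSupport (hc.fderiv (𝕜 := ℝ))
  rw [m1.eLpNorm_eq_integral_rpow_norm (by simp) (by simp),
    m2.eLpNorm_eq_integral_rpow_norm (by simp) (by simp), ← hC,
    ← ENNReal.ofReal_coe_nnreal (p := C), ← ENNReal.ofReal_mul (by positivity),
    ENNReal.ofReal_le_ofReal_iff (by positivity)] at key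
  rw [e1, e2]
  have q1 : ∀ x, ‖u x‖ ^ (((4 : NNReal) : ENNReal).toReal) = (u x) ^ 4 := by
    intro x
    have : (((4 : NNReal) : ENNReal).toReal) = ((4 : ℕ) : ℝ) := by simp
    rw [this, Real.rpow_natCast, Real.norm_eq_abs]
    exact (by decide : Even 4).pow_abs _
  have q2 : ∀ x, ‖fderiv ℝ u x‖ ^ (((2 : NNReal) : ENNReal).toReal) = ‖fderiv ℝ u x‖ ^ 2 := by
    intro x
    have : (((2 : NNReal) : ENNReal).toReal) = ((2 : ℕ) : ℝ) := by simp
    rw [this, Real.rpow_natCast]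
  simp only [q1, q2] at key
  have I1 : 0 ≤ ∫ x, (u x) ^ 4 := integral_nonneg (fun x => by positivity)
  have I2 : 0 ≤ ∫ x, ‖fderiv ℝ u x‖ ^ 2 := integral_nonneg (fun x => by positivity)
  have k4 := pow_le_pow_left₀ (by positivity) key 4
  have r1 : ((∫ x, (u x) ^ 4) ^ (((4 : NNReal) : ENNReal).toReal)⁻¹) ^ 4 = ∫ x, (u x) ^ 4 := by
    rw [← Real.rpow_natCast, ← Real.rpow_mul I1]; norm_num
  have r2 : ((∫ x, ‖fderiv ℝ u x‖ ^ 2) ^ (((2 : NNReal) : ENNReal).toReal)⁻¹) ^ 4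
      = (∫ x, ‖fderiv ℝ u x‖ ^ 2) ^ 2 := by
    rw [← Real.rpow_natCast, ← Real.rpow_mul I2, ← Real.rpow_natCast]; norm_num
  rw [mul_pow, r1, r2] at k4
  exact k4

lemma aux_pp_cont {Ω : Set E4} {u : E4 → ℝ} (hu : TestFun Ω u) : Continuous (pp u) := by
  unfold pp
  exact hu.1.continuous.max continuous_const

lemma aux_int_s10 {Ω : Set E4} {u : E4 → ℝ} (hu : TestFun Ω u) (g : ℝ → ℝ) (hg : Continuous g)
    (g0 : g 0 = 0) : Integrable (fun x => g (pp u x)) (volume.restrict Ω) := by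
  refine Integrable.restrict ?_
  refine (hg.comp (aux_pp_cont hu)).integrable_of_hasCompactSupport ?_
  have h := hu.2.1.comp_left (g := fun t => g (max t 0)) (by simp [g0])
  exact h

lemma aux_log_cont : Continuous (fun s : ℝ => s ^ 2 * (Real.log (s ^ 2) - 1)) := by
  have h : Continuous (fun s : ℝ => s ^ 2 * Real.log (s ^ 2) - s ^ 2) :=
    (Real.continuous_mul_log.comp (continuous_pow 2)).sub (continuous_pow 2)
  refine h.congr (fun s => by ring)

lemma aux_pt (lam θ : ℝ) (hθ : 0 < θ) (s : ℝ) :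
    lam / 2 * s ^ 2 + θ / 2 * (s ^ 2 * (Real.log (s ^ 2) - 1))
      ≤ θ / 2 * Real.exp (lam / θ - 1) * s ^ 4 := by
  rcases eq_or_ne s 0 with rfl | hs
  · simp
  have hs2 : 0 < s ^ 2 := by positivity
  have h := Real.log_le_self (x := Real.exp (lam / θ - 1) * s ^ 2) (by positivity)
  rw [Real.log_mul (Real.exp_ne_zero _) hs2.ne', Real.log_exp] at h
  have h2 := mul_le_mul_of_nonneg_left h (by positivity : 0 ≤ θ / 2 * s ^ 2)
  have h3 : θ / 2 * s ^ 2 * (lam / θ - 1 + Real.log (s ^ 2))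
    = lam / 2 * s ^ 2 + θ / 2 * (s ^ 2 * (Real.log (s ^ 2) - 1)) := by
    field_simp; ring
  rw [h3] at h2
  linarith

lemma aux_one {Ω : Set E4} {u : E4 → ℝ} (hu : TestFun Ω u) (lam θ : ℝ) (hθ : 0 < θ) :
    lam / 2 * (∫ x in Ω, (pp u x) ^ 2)
      + θ / 2 * (∫ x in Ω, (pp u x) ^ 2 * (Real.log ((pp u x) ^ 2) - 1))
      ≤ θ / 2 * Real.exp (lam / θ - 1) * ∫ x in Ω, (pp u x) ^ 4 := by
  have i1 := aux_int_s10 hu (fun s => s ^ 2) (by fun_prop) (by simp)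
  have i2 := aux_int_s10 hu _ aux_log_cont (by simp)
  have i3 := aux_int_s10 hu (fun s => s ^ 4) (by fun_prop) (by simp)
  rw [← integral_const_mul, ← integral_const_mul, ← integral_const_mul,
    ← integral_add (i1.const_mul _) (i2.const_mul _)]
  exact integral_mono ((i1.const_mul _).add (i2.const_mul _)) (i3.const_mul _)
    (fun x => aux_pt lam θ hθ (pp u x))

lemma aux_pp4 {Ω : Set E4} {u : E4 → ℝ} (hu : TestFun Ω u) :
    (∫ x in Ω, (pp u x) ^ 4) ≤ ∫ x in Ω, (u x) ^ 4 := by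
  have i3 := aux_int_s10 hu (fun s => s ^ 4) (by fun_prop) (by simp)
  have hc : HasCompactSupport (fun x => (u x) ^ 4) :=
    hu.2.1.comp_left (g := fun t : ℝ => t ^ 4) (by simp)
  have hcont : Continuous (fun x => (u x) ^ 4) := hu.1.continuous.pow 4
  have i4 : Integrable (fun x => (u x) ^ 4) (volume.restrict Ω) :=
    (hcont.integrable_of_hasCompactSupport hc).restrict
  refine integral_mono i3 i4 ?_
  intro x
  simp only [pp]
  rcases le_total (u x) 0 with h | h
  · rw [max_eq_right h, zero_pow (by norm_num)]; positivity
  · rw [max_eq_left h]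

lemma aux_cpl {Ω : Set E4} {u v : E4 → ℝ} (hu : TestFun Ω u) (hv : TestFun Ω v) :
    (∫ x in Ω, (pp u x) ^ 2 * (pp v x) ^ 2)
      ≤ (∫ x in Ω, (pp u x) ^ 4) + ∫ x in Ω, (pp v x) ^ 4 := by
  have i1 := aux_int_s10 hu (fun s => s ^ 4) (by fun_prop) (by simp)
  have i2 := aux_int_s10 hv (fun s => s ^ 4) (by fun_prop) (by simp)
  rw [← integral_add i1 i2]
  refine integral_mono_of_nonneg (Filter.Eventually.of_forall fun x => by positivity)
    (i1.add i2) (Filter.Eventually.of_forall fun x => ?_)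
  simp only []
  nlinarith [sq_nonneg (pp u x ^ 2 - pp v x ^ 2), sq_nonneg (pp u x ^ 2 + pp v x ^ 2)]

lemma aux_loglow (s : ℝ) : -1 ≤ s ^ 2 * (Real.log (s ^ 2) - 1) := by
  rcases eq_or_ne s 0 with rfl | hs
  · simp
  have hs2 : 0 < s ^ 2 := by positivity
  have h := Real.one_sub_inv_le_log_of_pos hs2
  have h2 := mul_le_mul_of_nonneg_left h hs2.le
  rw [mul_sub, mul_inv_cancel₀ hs2.ne'] at h2
  linarith

lemma aux_logint {Ω : Set E4} (hb : Bornology.IsBounded Ω) {u : E4 → ℝ} (hu : TestFun Ω u) :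
    -(volume.real Ω) ≤ ∫ x in Ω, (pp u x) ^ 2 * (Real.log ((pp u x) ^ 2) - 1) := by
  have i2 := aux_int_s10 hu _ aux_log_cont (by simp)
  have : IsFiniteMeasure (volume.restrict Ω) := ⟨by
    rw [Measure.restrict_apply_univ]; exact hb.measure_lt_top⟩
  have h := integral_mono (μ := volume.restrict Ω) (integrable_const (-1 : ℝ)) i2
    (fun x => aux_loglow (pp u x))
  simpa using h

lemma aux_bump {Ω : Set E4} (hne : Ω.Nonempty) (ho : IsOpen Ω) :
    ∃ φ : E4 → ℝ, TestFun Ω φ ∧ (∀ x, 0 ≤ φ x) ∧ 0 < ∫ x in Ω, (φ x) ^ 4 := by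
  obtain ⟨x0, hx0⟩ := hne
  obtain ⟨f, h1, h2, h3, h4, h5⟩ := exists_contDiff_tsupport_subset (n := ⊤) (ho.mem_nhds hx0)
  refine ⟨f, ⟨h3, h2, h1⟩, fun x => (h4 ⟨x, rfl⟩).1, ?_⟩
  have e1 : (∫ x in Ω, (f x) ^ 4) = ∫ x, (f x) ^ 4 := by
    apply setIntegral_eq_integral_of_forall_compl_eq_zero
    intro x hx
    rw [image_eq_zero_of_notMem_tsupport (fun h => hx (h1 h))]; norm_num
  rw [e1]
  refine Continuous.integral_pos_of_hasCompactSupport_nonneg_nonzero (x := x0)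
    (h3.continuous.pow 4) ?_ (fun x => ?_) ?_
  · exact h2.comp_left (g := fun t => t ^ 4) (by simp)
  · have := (h4 ⟨x, rfl⟩).1
    simp only [Pi.zero_apply]; positivity
  · simp [h5]

lemma aux_grad_smul {Ω : Set E4} {φ : E4 → ℝ} (hφ : TestFun Ω φ) (t : ℝ) :
    (∫ x in Ω, gradSq (fun y => t * φ y) x) = t ^ 2 * ∫ x in Ω, gradSq φ x := by
  rw [← integral_const_mul]
  congr 1
  ext x
  unfold gradSq
  rw [fderiv_const_mul ((hφ.1.differentiable (by simp)) x), norm_smul, mul_pow]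
  simp

lemma aux_grad_nonneg (Ω : Set E4) (u : E4 → ℝ) : 0 ≤ ∫ x in Ω, gradSq u x :=
  integral_nonneg (fun x => by unfold gradSq; positivity)

/-- Lemma 3.1 of the paper: for `θ₁, θ₂ > 0` and `β > max{μ₁,μ₂}` the functional `ℒ`
has a mountain pass geometry. -/
theorem stmt_10 (Ω : Set E4) (hΩne : Ω.Nonempty) (hΩo : IsOpen Ω)
    (hΩb : Bornology.IsBounded Ω)
    (lam1 lam2 μ₁ μ₂ θ₁ θ₂ β : ℝ) (hμ₁ : 0 < μ₁) (hμ₂ : 0 < μ₂)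
    (hθ₁ : 0 < θ₁) (hθ₂ : 0 < θ₂) (hβ : β > max μ₁ μ₂) :
    ∃ α ζ : ℝ, 0 < α ∧ 0 < ζ ∧
      (∀ u v : E4 → ℝ, TestFun Ω u → TestFun Ω v →
        Real.sqrt ((∫ x in Ω, gradSq u x) + (∫ x in Ω, gradSq v x)) = ζ →
        LL Ω lam1 μ₁ θ₁ lam2 μ₂ θ₂ β u v ≥ α) ∧
      (∃ w z : E4 → ℝ, TestFun Ω w ∧ TestFun Ω z ∧
        Real.sqrt ((∫ x in Ω, gradSq w x) + (∫ x in Ω, gradSq z x)) ≥ ζ ∧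
        LL Ω lam1 μ₁ θ₁ lam2 μ₂ θ₂ β w z < 0) := by
  obtain ⟨K, hK0, hK⟩ := aux_sobolev Ω
  have hβ0 : 0 < β := lt_trans (lt_of_lt_of_le hμ₁ (le_max_left _ _)) hβ
  obtain ⟨C1, hC1⟩ : ∃ C, C = θ₁ / 2 * Real.exp (lam1 / θ₁ - 1) := ⟨_, rfl⟩
  obtain ⟨C2, hC2⟩ : ∃ C, C = θ₂ / 2 * Real.exp (lam2 / θ₂ - 1) := ⟨_, rfl⟩
  have hC1p : 0 < C1 := by rw [hC1]; positivity
  have hC2p : 0 < C2 := by rw [hC2]; positivity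
  obtain ⟨C, hC⟩ : ∃ C, C = C1 + C2 + μ₁ / 4 + μ₂ / 4 + β / 2 := ⟨_, rfl⟩
  have hCp : 0 < C := by rw [hC]; positivity
  obtain ⟨M, hM⟩ : ∃ M, M = C * K + 1 := ⟨_, rfl⟩
  have hMp : 0 < M := by rw [hM]; positivity
  refine ⟨1 / (16 * M), Real.sqrt (1 / (4 * M)), by positivity, by positivity, ?_, ?_⟩
  · intro u v hu hv hz
    have hA := aux_grad_nonneg Ω u
    have hB := aux_grad_nonneg Ω v
    rw [Real.sqrt_inj (by positivity) (by positivity)] at hz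
    have o1 := aux_one hu lam1 θ₁ hθ₁
    have o2 := aux_one hv lam2 θ₂ hθ₂
    rw [← hC1] at o1
    rw [← hC2] at o2
    have d1 := (aux_pp4 hu).trans (hK u hu)
    have d2 := (aux_pp4 hv).trans (hK v hv)
    have c := mul_le_mul_of_nonneg_left (aux_cpl hu hv) (by positivity : 0 ≤ β / 2)
    have p1 : 0 ≤ ∫ x in Ω, (pp u x) ^ 4 := integral_nonneg (fun x => by positivity)
    have p2 : 0 ≤ ∫ x in Ω, (pp v x) ^ 4 := integral_nonneg (fun x => by positivity)
    unfold LL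
    generalize (∫ x in Ω, gradSq u x) = A at *
    generalize (∫ x in Ω, gradSq v x) = B at *
    generalize (∫ x in Ω, (pp u x) ^ 4) = D at *
    generalize (∫ x in Ω, (pp v x) ^ 4) = E at *
    have g1 : C1 * D + C2 * E + μ₁ / 4 * D + μ₂ / 4 * E + β / 2 * (D + E) ≤ C * (D + E) := by
      rw [hC]
      have := mul_nonneg hC1p.le p2
      have := mul_nonneg hC2p.le p1
      have := mul_nonneg hμ₁.le p2
      have := mul_nonneg hμ₂.le p1
      linarith
    have g2 : C * (D + E) ≤ C * (K * (A + B) ^ 2) := by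
      apply mul_le_mul_of_nonneg_left _ hCp.le
      have := mul_nonneg hK0 (mul_nonneg hA hB)
      nlinarith
    have g3 : C * (K * (A + B) ^ 2) ≤ M * (A + B) ^ 2 := by
      rw [hM]; nlinarith [sq_nonneg (A + B)]
    have g4 : 1 / 2 * (A + B) - M * (A + B) ^ 2 = 1 / (16 * M) := by
      rw [hz]; field_simp; ring
    linarith
  · obtain ⟨φ, hφ, hφ0, hφ4⟩ := aux_bump hΩne hΩo
    have hA : 0 < ∫ x in Ω, gradSq φ x := by
      refine lt_of_le_of_ne (aux_grad_nonneg Ω φ) (fun h => ?_)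
      have := hK φ hφ
      rw [← h] at this
      norm_num at this
      linarith
    have hw : ∀ t : ℝ, TestFun Ω (fun y => t * φ y) := fun t =>
      ⟨contDiff_const.mul hφ.1, hφ.2.1.mul_left,
        (closure_mono (Function.support_mul_subset_right _ _)).trans hφ.2.2⟩
    have h0 : TestFun Ω (fun _ => (0 : ℝ)) := by simpa using hw 0
    have hpp : ∀ t : ℝ, 0 ≤ t → ∀ x, pp (fun y => t * φ y) x = t * φ x := fun t ht x =>
      max_eq_left (mul_nonneg ht (hφ0 x))
    have hg0 : (∫ x in Ω, gradSq (fun _ => (0 : ℝ)) x) = 0 := by simp [gradSq]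
    obtain ⟨P, hP⟩ : ∃ P, P = |1 / 2 * (∫ x in Ω, gradSq φ x)
      - lam1 / 2 * ∫ x in Ω, (φ x) ^ 2| := ⟨_, rfl⟩
    obtain ⟨Q, hQ⟩ : ∃ Q, Q = μ₁ / 4 * ∫ x in Ω, (φ x) ^ 4 := ⟨_, rfl⟩
    obtain ⟨R, hR⟩ : ∃ R, R = θ₁ / 2 * volume.real Ω := ⟨_, rfl⟩
    have hP0 : 0 ≤ P := by rw [hP]; positivity
    have hQ0 : 0 < Q := by rw [hQ]; positivity
    have hR0 : 0 ≤ R := by rw [hR]; positivity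
    obtain ⟨s, hs⟩ : ∃ s, s = 1 + 1 / (4 * M) / (∫ x in Ω, gradSq φ x) + (P + R) / Q := ⟨_, rfl⟩
    have hx1 : 0 ≤ 1 / (4 * M) / (∫ x in Ω, gradSq φ x) := by positivity
    have hx2 : 0 ≤ (P + R) / Q := by positivity
    have hs1 : 1 ≤ s := by linarith
    have hsA : 1 / (4 * M) ≤ s * ∫ x in Ω, gradSq φ x := by
      rw [← div_le_iff₀ hA]; linarith
    have hsQ : P + R + Q ≤ s * Q := by
      have : (P + R) / Q + 1 ≤ s := by linarith
      have := mul_le_mul_of_nonneg_right this hQ0.le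
      rw [add_mul, div_mul_cancel₀ _ hQ0.ne'] at this
      linarith
    have ht2 : Real.sqrt s ^ 2 = s := Real.sq_sqrt (by linarith)
    have ht4 : Real.sqrt s ^ 4 = s ^ 2 := by rw [show Real.sqrt s ^ 4 = (Real.sqrt s ^ 2) ^ 2 by ring, ht2]
    refine ⟨fun y => Real.sqrt s * φ y, fun _ => 0, hw _, h0, ?_, ?_⟩
    · apply Real.sqrt_le_sqrt
      rw [hg0, aux_grad_smul hφ, ht2]
      linarith
    · have hl := mul_le_mul_of_nonneg_left (aux_logint hΩb (hw (Real.sqrt s)))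
        (by positivity : 0 ≤ θ₁ / 2)
      unfold LL
      have z0 : ∀ x, pp (fun _ => (0 : ℝ)) x = 0 := fun x => by simp [pp]
      have e2 : (∫ x in Ω, (pp (fun y => Real.sqrt s * φ y) x) ^ 2)
          = s * ∫ x in Ω, (φ x) ^ 2 := by
        rw [← integral_const_mul]
        simp only [hpp _ (Real.sqrt_nonneg s), mul_pow, ht2]
      have e4 : (∫ x in Ω, (pp (fun y => Real.sqrt s * φ y) x) ^ 4)
          = s ^ 2 * ∫ x in Ω, (φ x) ^ 4 := by
        rw [← integral_const_mul]
        simp only [hpp _ (Real.sqrt_nonneg s), mul_pow, ht4]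
      rw [hg0, aux_grad_smul hφ, ht2, e2, e4]
      simp only [z0]
      norm_num
      norm_num at hl
      have hPle := le_abs_self (1 / 2 * (∫ x in Ω, gradSq φ x)
        - lam1 / 2 * ∫ x in Ω, (φ x) ^ 2)
      rw [← hP] at hPle
      have k1 := mul_le_mul_of_nonneg_left hPle (by linarith : 0 ≤ s)
      have k2 := mul_le_mul_of_nonneg_left hsQ (by linarith : 0 ≤ s)
      have k3 : R ≤ s * R := le_mul_of_one_le_left hR0 hs1
      have k4 : 0 < s * Q := by positivity
      have k5 : s * (s * Q) = μ₁ / 4 * (s ^ 2 * ∫ x in Ω, (φ x) ^ 4) := by rw [hQ]; ring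
      rw [← hR] at hl
      linarith
end
end
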